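/- arXiv:2303.00940 — 3 statements merged into one kernel-verified Lean document; each statement's English description precedes it below -/
import Mathlib

section
/- Model a chain join of n relations as follows: for each i ∈ {1, …, n} let R_i be a finite set of tuples (of some type β_i), and for each i ∈ {1, …, n−1} let joinable_i : β_i → β_{i+1} → Prop be the join condition between consecutive relations. Let J be the set of n-tuples (t_1, …, t_n) with t_i ∈ R_i for all i and joinable_i(t_i, t_{i+1}) for all i < n. For i ≥ 2 let M_i be the maximum over all tuples t of the number of tuples t' ∈ R_i with joinable_{i−1}(t, t'). Then |J| ≤ |R_1| · Π_{i=2}^n M_i. -/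
open Classical in
theorem chain_join_aux.{u} (n : ℕ) : ∀ (β : Fin (n + 1) → Type u)
    (R : ∀ i, Finset (β i))
    (joinable : ∀ i : Fin n, β i.castSucc → β i.succ → Prop)
    (J : Finset (∀ i, β i))
    (_ : ∀ t ∈ J, (∀ i, t i ∈ R i) ∧ ∀ i : Fin n, joinable i (t i.castSucc) (t i.succ))
    (M : Fin n → ℕ)
    (_ : ∀ i t, ((R i.succ).filter (fun t' => joinable i t t')).card ≤ M i),
    J.card ≤ (R 0).card * ∏ i : Fin n, M i := by
  induction n with
  | zero =>
    intro β R joinable J hJ M hM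
    simp only [Finset.univ_eq_empty, Finset.prod_empty, mul_one]
    refine Finset.card_le_card_of_injOn (fun t => t 0) (fun t ht => (hJ t ht).1 0) ?_
    intro t _ t' _ h
    funext i
    obtain rfl : i = 0 := by omega
    exact h
  | succ n ih =>
    intro β R joinable J hJ M hM
    have h1 := ih (fun i => β i.castSucc) (fun i => R i.castSucc)
      (fun i => joinable i.castSucc) (J.image (fun t i => t i.castSucc))
      (by
        intro t ht
        obtain ⟨s, hs, rfl⟩ := Finset.mem_image.1 ht
        exact ⟨fun i => (hJ s hs).1 _, fun i => (hJ s hs).2 i.castSucc⟩)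
      (fun i => M i.castSucc) (fun i t => hM i.castSucc t)
    have h2 := Finset.card_le_mul_card_image (f := fun (t : ∀ i, β i) (i : Fin (n + 1)) => t i.castSucc)
      J (M (Fin.last n)) (by
        intro a _
        refine le_trans ?_ (hM (Fin.last n) (a (Fin.last n)))
        refine Finset.card_le_card_of_injOn (fun t => t (Fin.last n).succ) ?_ ?_
        · intro t ht
          obtain ⟨hs, rfl⟩ := Finset.mem_filter.1 ht
          exact Finset.mem_filter.2 ⟨(hJ t hs).1 _, (hJ t hs).2 _⟩
        · intro t ht t' ht' h
          have e := (Finset.mem_filter.1 ht).2.trans (Finset.mem_filter.1 ht').2.symm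
          funext i
          induction i using Fin.lastCases with
          | last => exact h
          | cast i => exact congrFun e i)
    rw [Fin.prod_univ_castSucc, ← mul_assoc, mul_comm _ (M (Fin.last n))]
    exact h2.trans (Nat.mul_le_mul_left _ h1)

/-- **extended Olken bound.** Model a chain join of `n+1` relations: each
`R i` is a finite set of tuples of type `β i`, and `joinable i` is the join condition
between consecutive relations `R i` and `R (i+1)`. Let `J` be the set of tuples
`(t 0, …, t n)` with `t i ∈ R i` for all `i` and `joinable i (t i) (t (i+1))` for all
join steps `i`. With `M i` the maximum, over all tuples `t`, of the number of
`t' ∈ R (i+1)` with `joinable i t t'`, we have `|J| ≤ |R 0| · Π_i M i`. -/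
theorem chain_join_card_le_olken (n : ℕ) (β : Fin (n + 1) → Type*)
    (R : ∀ i, Finset (β i))
    (joinable : ∀ i : Fin n, β i.castSucc → β i.succ → Prop)
    [∀ i t t', Decidable (joinable i t t')]
    (J : Finset (∀ i, β i))
    (hJ : J = (Fintype.piFinset R).filter
      (fun t => ∀ i : Fin n, joinable i (t i.castSucc) (t i.succ)))
    (M : Fin n → ℕ)
    (hM : ∀ i, M i = ⨆ t : β i.castSucc,
      ((R i.succ).filter (fun t' => joinable i t t')).card) :
    J.card ≤ (R 0).card * ∏ i : Fin n, M i := by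
  classical
  subst hJ
  refine chain_join_aux n β R joinable _ ?_ M ?_
  · intro t ht
    obtain ⟨h1, h2⟩ := Finset.mem_filter.1 ht
    exact ⟨Fintype.mem_piFinset.1 h1, h2⟩
  · intro i t
    rw [hM]
    have hb : BddAbove (Set.range fun t : β i.castSucc =>
        ((R i.succ).filter (fun t' => joinable i t t')).card) := by
      refine ⟨(R i.succ).card, ?_⟩
      rintro _ ⟨t, rfl⟩
      exact Finset.card_filter_le _ _
    refine le_trans (le_of_eq ?_) (le_ciSup hb t)
    congr
end

section
/- Let K be a type of key values and let α, β be tuple types with key maps κ_1 : α → K and κ_2 : β → K. For each j ∈ {1, …, m}, let R_{j,1} be a finite subset of α and R_{j,2} a finite subset of β, and let J_j = {(a, b) : a ∈ R_{j,1}, b ∈ R_{j,2}, κ_1(a) = κ_2(b)} be the two-relation key join. For a key value v, let d_1^j(v) = |{a ∈ R_{j,1} : κ_1(a) = v}| and d_2^j(v) = |{b ∈ R_{j,2} : κ_2(b) = v}|. Then the size of the overlap of the joins satisfies |J_1 ∩ … ∩ J_m| ≤ Σ_v min_{1 ≤ j ≤ m} ( d_1^j(v) · d_2^j(v) ), where the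 sum ranges over all key values v occurring in any of the relations. -/
/-- **base case of the histogram-based overlap bound, Theorem 5.1.**
For each `j`, let `J j` be the two-relation key join of `R j ⊆ α` and `S j ⊆ β` on key maps
`κ₁ : α → K`, `κ₂ : β → K`, and let `d₁ j v`, `d₂ j v` be the degrees of key value `v` in
`R j` and `S j`. Then the overlap of the joins satisfies
`|J 1 ∩ … ∩ J m| ≤ Σ_v min_j (d₁ j v · d₂ j v)`, the sum ranging over all key values
occurring in any of the relations. -/
theorem key_join_overlap_le_sum_min_degrees {K α β : Type*}
    [DecidableEq K] [DecidableEq α] [DecidableEq β]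
    (m : ℕ) (hm : 0 < m) (κ₁ : α → K) (κ₂ : β → K)
    (R : Fin m → Finset α) (S : Fin m → Finset β)
    (J : Fin m → Finset (α × β))
    (hJ : ∀ j, J j = (R j ×ˢ S j).filter (fun p => κ₁ p.1 = κ₂ p.2))
    (d₁ : Fin m → K → ℕ) (d₂ : Fin m → K → ℕ)
    (hd₁ : ∀ j v, d₁ j v = ((R j).filter (fun a => κ₁ a = v)).card)
    (hd₂ : ∀ j v, d₂ j v = ((S j).filter (fun b => κ₂ b = v)).card) :
    ((J ⟨0, hm⟩).filter (fun p => ∀ j : Fin m, p ∈ J j)).card ≤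
      ∑ v ∈ (Finset.univ.biUnion fun j => (R j).image κ₁) ∪
              (Finset.univ.biUnion fun j => (S j).image κ₂),
        Finset.univ.inf' ⟨⟨0, hm⟩, Finset.mem_univ _⟩ (fun j => d₁ j v * d₂ j v) := by
  rw [Finset.card_eq_sum_card_fiberwise (f := fun p : α × β => κ₁ p.1)
    (t := (Finset.univ.biUnion fun j => (R j).image κ₁) ∪
              (Finset.univ.biUnion fun j => (S j).image κ₂))]
  · apply Finset.sum_le_sum
    intro v _
    apply Finset.le_inf'
    intro j _
    rw [hd₁, hd₂, ← Finset.card_product]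
    apply Finset.card_le_card
    intro p hp
    rw [Finset.mem_filter, Finset.mem_filter] at hp
    obtain ⟨⟨_, h⟩, hv⟩ := hp
    have h2 := h j
    rw [hJ, Finset.mem_filter, Finset.mem_product] at h2
    rw [Finset.mem_product, Finset.mem_filter, Finset.mem_filter]
    exact ⟨⟨h2.1.1, hv⟩, h2.1.2, h2.2.symm.trans hv⟩
  · intro p hp
    have h1 := (Finset.mem_filter.mp (Finset.mem_coe.mp hp)).1
    rw [hJ, Finset.mem_filter, Finset.mem_product] at h1
    apply Finset.mem_coe.mpr
    apply Finset.mem_union_left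
    exact Finset.mem_biUnion.mpr ⟨_, Finset.mem_univ _, Finset.mem_image_of_mem κ₁ h1.1.1⟩
end

section
/- Let γ be a type of prefix tuples and β a type of tuples, and let joinable : γ → β → Prop be a join condition shared across joins. For each j ∈ {1, …, m}, let P_j be a finite subset of γ and R_j a finite subset of β, and define the extended join E_j = {(p, t) : p ∈ P_j, t ∈ R_j, joinable(p, t)}. Let M_j = max_{p ∈ γ} |{t ∈ R_j : joinable(p, t)}| be the maximum degree of R_j. Then |E_1 ∩ … ∩ E_m| ≤ |P_1 ∩ … ∩ P_m| · min_{1 ≤ j ≤ m} M_j. -/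
/-- **inductive step of the histogram-based overlap bound, Theorem 5.1.**
For each `j`, let `E j` be the extended join pairing prefixes `p ∈ P j ⊆ γ` with tuples
`t ∈ R j ⊆ β` satisfying a shared join condition `joinable p t`, and let
`M j` be the maximum, over all prefixes `p`, of the number of tuples of `R j` joinable
with `p`. Then `|E 1 ∩ … ∩ E m| ≤ |P 1 ∩ … ∩ P m| · min_j M j`. -/
theorem extended_join_overlap_le {γ β : Type*} [DecidableEq γ] [DecidableEq β]
    (m : ℕ) (hm : 0 < m)
    (joinable : γ → β → Prop) [∀ p t, Decidable (joinable p t)]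
    (P : Fin m → Finset γ) (R : Fin m → Finset β)
    (E : Fin m → Finset (γ × β))
    (hE : ∀ j, E j = (P j ×ˢ R j).filter (fun x => joinable x.1 x.2))
    (M : Fin m → ℕ)
    (hM : ∀ j, M j = ⨆ p : γ, ((R j).filter (fun t => joinable p t)).card) :
    ((E ⟨0, hm⟩).filter (fun x => ∀ j : Fin m, x ∈ E j)).card ≤
      ((P ⟨0, hm⟩).filter (fun p => ∀ j : Fin m, p ∈ P j)).card *
        Finset.univ.inf' ⟨⟨0, hm⟩, Finset.mem_univ _⟩ M := by
  obtain ⟨j, -, hj⟩ := Finset.exists_mem_eq_inf' (s := (Finset.univ : Finset (Fin m)))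
    ⟨⟨0, hm⟩, Finset.mem_univ _⟩ M
  rw [hj, mul_comm]
  have hmem : ∀ i x, x ∈ E i ↔ (x.1 ∈ P i ∧ x.2 ∈ R i) ∧ joinable x.1 x.2 := by
    intro i x
    rw [hE i, Finset.mem_filter, Finset.mem_product]
  refine Finset.card_le_mul_card_image_of_maps_to (f := Prod.fst) ?_ (M j) ?_
  · intro x hx
    rw [Finset.mem_filter] at hx ⊢
    exact ⟨((hmem _ x).1 hx.1).1.1, fun i => ((hmem i x).1 (hx.2 i)).1.1⟩
  · intro p _
    have hbdd : BddAbove (Set.range fun p : γ =>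
        ((R j).filter (fun t => joinable p t)).card) := by
      refine ⟨(R j).card, ?_⟩
      rintro _ ⟨q, rfl⟩
      exact Finset.card_filter_le _ _
    rw [hM j]
    refine le_trans ?_ (le_ciSup hbdd p)
    refine Finset.card_le_card_of_injOn Prod.snd ?_ ?_
    · intro x hx
      obtain ⟨hxs, rfl⟩ := Finset.mem_filter.1 hx
      have h := (hmem j x).1 ((Finset.mem_filter.1 hxs).2 j)
      exact Finset.mem_filter.2 ⟨h.1.2, h.2⟩
    · intro x hx y hy hxy
      exact Prod.ext ((Finset.mem_filter.1 hx).2.trans (Finset.mem_filter.1 hy).2.symm) hxy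
end
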